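/- Let β ∈ (0, 1/2] and δ ∈ (0, β/4]. Let T be a finite multiset of reals in [δ, 1] whose number of elements satisfies |T| ≥ 2/(β·δ), and let A be a finite multiset of reals in (0, δ). Let N be a natural number with Opt(T) ≤ N ≤ (1+β)·Opt(T). Then Opt(T ∪ A) ≤ max(N, (Σ_{a ∈ T∪A} a)/(1−δ) + 1) ≤ (1+2β)·Opt(T ∪ A). -/

import Mathlib

/-- `P` is a packing of the multiset `L` of items into bins of size 1:
it partitions `L` into sub-multisets, each of total sum at most 1. -/
def IsBinPacking (L : Multiset ℝ) (P : Multiset (Multiset ℝ)) : Prop :=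
  P.join = L ∧ ∀ b ∈ P, b.sum ≤ 1

/-- `binOpt L` is the minimum number of bins of size 1 needed to pack `L`. -/
noncomputable def binOpt (L : Multiset ℝ) : ℕ :=
  sInf {N | ∃ P : Multiset (Multiset ℝ), IsBinPacking L P ∧ P.card = N}

lemma binOpt_le_card {L : Multiset ℝ} {P : Multiset (Multiset ℝ)} (h : IsBinPacking L P) :
    binOpt L ≤ P.card := Nat.sInf_le ⟨P, h, rfl⟩

lemma exists_packing_binOpt {L : Multiset ℝ} (hL : ∀ x ∈ L, x ≤ 1) :
    ∃ P, IsBinPacking L P ∧ P.card = binOpt L := by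
  have : {N | ∃ P : Multiset (Multiset ℝ), IsBinPacking L P ∧ P.card = N}.Nonempty := by
    refine ⟨_, L.map (fun x => {x}), ⟨?_, ?_⟩, rfl⟩
    · clear hL
      induction L using Multiset.induction_on with
      | empty => simp
      | cons a s ih => simp [ih]
    · intro b hb
      obtain ⟨x, hx, rfl⟩ := Multiset.mem_map.1 hb
      simpa using hL x hx
  exact Nat.sInf_mem this

lemma packing_remove {T A : Multiset ℝ} (hA : ∀ x ∈ A, 0 < x) :
    ∀ P, IsBinPacking (T + A) P → ∃ Q, IsBinPacking T Q ∧ Q.card = P.card := by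
  induction A using Multiset.induction_on with
  | empty => intro P hP; exact ⟨P, by simpa using hP, rfl⟩
  | cons a s ih =>
    intro P hP
    have ha : a ∈ P.join := by rw [hP.1]; simp
    obtain ⟨b, hb, hab⟩ := Multiset.mem_join.1 ha
    obtain ⟨P', rfl⟩ := Multiset.exists_cons_of_mem hb
    obtain ⟨b', rfl⟩ := Multiset.exists_cons_of_mem hab
    have h1 := hP.1
    have h2 := hP.2
    have ha0 := hA a (by simp)
    obtain ⟨Q, hQ, hc⟩ := ih (fun x hx => hA x (by simp [hx])) (b' ::ₘ P') (by
      refine ⟨?_, ?_⟩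
      · simpa using h1
      · intro c hc
        rcases Multiset.mem_cons.1 hc with rfl | hc
        · have := h2 (a ::ₘ c) (by simp)
          rw [Multiset.sum_cons] at this
          linarith
        · exact h2 c (by simp [hc]))
    exact ⟨Q, hQ, by simpa using hc⟩

lemma join_sum_le (P : Multiset (Multiset ℝ)) (h : ∀ b ∈ P, b.sum ≤ 1) :
    P.join.sum ≤ P.card := by
  induction P using Multiset.induction_on with
  | empty => simp
  | cons a s ih =>
    have h1 := ih (fun b hb => h b (by simp [hb]))
    have h2 := h a (by simp)
    simp only [Multiset.join_cons, Multiset.sum_add, Multiset.card_cons]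
    push_cast; linarith

lemma le_join_sum (c : ℝ) (P : Multiset (Multiset ℝ)) (h : ∀ b ∈ P, c ≤ b.sum) :
    P.card * c ≤ P.join.sum := by
  induction P using Multiset.induction_on with
  | empty => simp
  | cons a s ih =>
    have h1 := ih (fun b hb => h b (by simp [hb]))
    have h2 := h a (by simp)
    simp only [Multiset.join_cons, Multiset.sum_add, Multiset.card_cons]
    push_cast; linarith

lemma fill_small (δ : ℝ) (hδ : δ < 1) (hδ0 : 0 < δ) (T A : Multiset ℝ) (N : ℕ)
    (hA : ∀ x ∈ A, 0 < x ∧ x < δ) (hT : ∃ P, IsBinPacking T P ∧ P.card ≤ N) :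
    ∃ P, IsBinPacking (T + A) P ∧ (P.card : ℝ) ≤ max (N : ℝ) ((T + A).sum / (1 - δ) + 1) := by
  induction A using Multiset.induction_on with
  | empty =>
    obtain ⟨P, h, hc⟩ := hT
    exact ⟨P, by simpa using h, le_max_of_le_left (by exact_mod_cast hc)⟩
  | cons a s ih =>
    obtain ⟨P, hP, hc⟩ := ih (fun x hx => hA x (by simp [hx]))
    obtain ⟨ha0, ha⟩ := hA a (by simp)
    have hd : 0 < 1 - δ := by linarith
    have hsum : (T + a ::ₘ s).sum = (T + s).sum + a := by
      simp only [Multiset.sum_add, Multiset.sum_cons]; ring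
    have hmono : (T + s).sum / (1 - δ) ≤ (T + a ::ₘ s).sum / (1 - δ) := by
      rw [hsum]; gcongr; linarith
    by_cases hex : ∃ b ∈ P, b.sum ≤ 1 - a
    · obtain ⟨b, hb, hba⟩ := hex
      obtain ⟨P', rfl⟩ := Multiset.exists_cons_of_mem hb
      refine ⟨(a ::ₘ b) ::ₘ P', ⟨?_, ?_⟩, ?_⟩
      · have := hP.1
        simp only [Multiset.join_cons] at this
        simp [this]
      · intro c hc
        rcases Multiset.mem_cons.1 hc with rfl | hc
        · rw [Multiset.sum_cons]; linarith
        · exact hP.2 c (by simp [hc])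
      · simp only [Multiset.card_cons] at hc ⊢
        exact hc.trans (max_le_max le_rfl (by linarith))
    · push Not at hex
      refine ⟨{a} ::ₘ P, ⟨?_, ?_⟩, ?_⟩
      · simp [hP.1]
      · intro c hc
        rcases Multiset.mem_cons.1 hc with rfl | hc
        · simp; linarith
        · exact hP.2 c hc
      · have := le_join_sum (1 - δ) P (fun b hb => by linarith [hex b hb])
        rw [hP.1, ← le_div_iff₀ hd] at this
        apply le_max_of_le_right
        rw [Multiset.card_cons]; push_cast; linarith

theorem fill_small_items_approx (β δ : ℝ)
    (hβ : 0 < β ∧ β ≤ 1 / 2) (hδ : 0 < δ ∧ δ ≤ β / 4)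
    (T A : Multiset ℝ)
    (hT : ∀ x ∈ T, δ ≤ x ∧ x ≤ 1)
    (hTcard : 2 / (β * δ) ≤ (T.card : ℝ))
    (hA : ∀ x ∈ A, 0 < x ∧ x < δ)
    (N : ℕ) (hN1 : binOpt T ≤ N) (hN2 : (N : ℝ) ≤ (1 + β) * binOpt T) :
    (binOpt (T + A) : ℝ) ≤ max (N : ℝ) ((T + A).sum / (1 - δ) + 1) ∧
    max (N : ℝ) ((T + A).sum / (1 - δ) + 1) ≤ (1 + 2 * β) * binOpt (T + A) := by
  obtain ⟨hβ0, hβ1⟩ := hβ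
  obtain ⟨hδ0, hδ1⟩ := hδ
  have hd : 0 < 1 - δ := by linarith
  constructor
  · obtain ⟨P, hP, hc⟩ := exists_packing_binOpt (fun x hx => (hT x hx).2)
    obtain ⟨Q, hQ, hq⟩ := fill_small δ (by linarith) hδ0 T A N hA ⟨P, hP, hc ▸ hN1⟩
    exact le_trans (by exact_mod_cast binOpt_le_card hQ) hq
  · obtain ⟨P, hP, hc⟩ := exists_packing_binOpt (L := T + A) (fun x hx => by
      rcases Multiset.mem_add.1 hx with h | h
      · exact (hT x h).2
      · linarith [(hA x h).2])
    obtain ⟨Q, hQ, hq⟩ := packing_remove (fun x hx => (hA x hx).1) P hP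
    have hle : (binOpt T : ℝ) ≤ binOpt (T + A) := by
      have := binOpt_le_card hQ
      rw [hq, hc] at this
      exact_mod_cast this
    have hS := join_sum_le P hP.2
    rw [hP.1, hc] at hS
    have hTs : (T.card : ℝ) * δ ≤ T.sum := by
      have := Multiset.card_nsmul_le_sum (s := T) (a := δ) (fun x hx => (hT x hx).1)
      simpa using this
    have hAs : 0 ≤ A.sum := Multiset.sum_nonneg (fun x hx => (hA x hx).1.le)
    have h2 : 2 ≤ β * (T.card * δ) := by
      rw [div_le_iff₀ (by positivity)] at hTcard
      linarith
    have hO : (T.card : ℝ) * δ ≤ binOpt (T + A) := by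
      rw [Multiset.sum_add] at hS; linarith
    set O : ℝ := (binOpt (T + A) : ℝ)
    have hO2 : 2 ≤ β * O := h2.trans (by gcongr)
    have hO0 : 0 ≤ O := Nat.cast_nonneg _
    apply max_le
    · have : (1 + β) * (binOpt T : ℝ) ≤ (1 + β) * O := by gcongr
      linarith
    · have : (T + A).sum / (1 - δ) ≤ (1 + β) * O := by
        rw [div_le_iff₀ hd]
        have : 1 ≤ (1 + β) * (1 - δ) := by nlinarith
        nlinarith
      linarith
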